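/- arXiv:2505.03106 — 4 statements merged into one kernel-verified Lean document; each statement's English description precedes it below -/
import Mathlib

section
/- Let n ≥ 3 and −1 < α < ∞. There exist positive constants C₁ and C₂ depending only on n and α such that for every x ∈ ∂𝔹_n and every 0 < r < 1, C₁·r^{n+α}·(2−r)^{α+1} ≤ ν_α(B̂_ρ(x,r)) ≤ C₂·r^{n+α}·(2−r)^{α+1}. -/
open MeasureTheory Metric
open scoped ENNReal RealInnerProductSpace

noncomputable section

abbrev Eucl (n : ℕ) : Type := EuclideanSpace ℝ (Fin n)

/-- The spherical (angular) distance `ρ(x,y) = arccos ⟨x,y⟩`. -/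
def rho {n : ℕ} (x y : Eucl n) : ℝ := Real.arccos ⟪x, y⟫

/-- The (unnormalized) weighted measure `(1-|x|²)^α dν` on the unit ball. -/
def muA (n : ℕ) (α : ℝ) : Measure (Eucl n) :=
  (volume.restrict (ball (0 : Eucl n) 1)).withDensity
    fun x => ENNReal.ofReal ((1 - ‖x‖ ^ 2) ^ α)

/-- The normalized weighted measure `ν_α` with `ν_α(𝔹_n) = 1`. -/
def nuA (n : ℕ) (α : ℝ) : Measure (Eucl n) := (muA n α Set.univ)⁻¹ • muA n α

/-- The spherical ball `B_ρ(x,r)` on the unit sphere. -/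
def sBall {n : ℕ} (x : Eucl n) (r : ℝ) : Set (Eucl n) := {y | ‖y‖ = 1 ∧ rho x y < r}

/-- The Carleson box of the spherical ball `B_ρ(x,r)`. -/
def cBoxBall {n : ℕ} (x : Eucl n) (r : ℝ) : Set (Eucl n) :=
  {z | ‖z‖ < 1 ∧ 1 - r < ‖z‖ ∧ ‖z‖⁻¹ • z ∈ sBall x r}

/-- The `ρ`-diameter of a subset of the sphere. -/
def diamRho {n : ℕ} (Q : Set (Eucl n)) : ℝ :=
  sSup {d | ∃ x ∈ Q, ∃ y ∈ Q, d = rho x y}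

/-- The Carleson box of a subset `Q` of the sphere. -/
def cBox {n : ℕ} (Q : Set (Eucl n)) : Set (Eucl n) :=
  {z | ‖z‖ < 1 ∧ 1 - diamRho Q / 2 < ‖z‖ ∧ ‖z‖⁻¹ • z ∈ Q}

/-- The `ε`-Carleson box of a subset `Q` of the sphere. -/
def cBoxEps {n : ℕ} (ε : ℝ) (Q : Set (Eucl n)) : Set (Eucl n) :=
  {z | ‖z‖ < 1 ∧ 1 - ε * diamRho Q / 2 < ‖z‖ ∧ ‖z‖⁻¹ • z ∈ Q}

/-- `|S|_{ω,α} = ∫_S ω dν_α`. -/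
def wInt {n : ℕ} (α : ℝ) (ω : Eucl n → ℝ) (S : Set (Eucl n)) : ℝ≥0∞ :=
  ∫⁻ x in S, ENNReal.ofReal (ω x) ∂(nuA n α)

/-- The Bekollé–Bonami constant `[ω]_{p,α}` (with `p' = p/(p-1)`). -/
def BB (n : ℕ) (p α : ℝ) (ω : Eucl n → ℝ) : ℝ≥0∞ :=
  ⨆ (x : Eucl n) (_ : ‖x‖ = 1) (r : ℝ) (_ : 0 < r) (_ : r < 1),
    (wInt α ω (cBoxBall x r) / nuA n α (cBoxBall x r)) *
      (wInt α (fun y => ω y ^ (1 - p / (p - 1))) (cBoxBall x r) /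
        nuA n α (cBoxBall x r)) ^ (p - 1)

/-- The maximal operator `M_α` over Carleson boxes of spherical balls. -/
def maxOp (n : ℕ) (α : ℝ) (f : Eucl n → ℝ) (x : Eucl n) : ℝ≥0∞ :=
  ⨆ (ξ : Eucl n) (_ : ‖ξ‖ = 1) (r : ℝ) (_ : 0 < r) (_ : r < 1),
    (cBoxBall ξ r).indicator
      (fun _ => (∫⁻ y in cBoxBall ξ r, ENNReal.ofReal |f y| ∂(nuA n α)) /
        nuA n α (cBoxBall ξ r)) x

/-- The `L^q(ω dν_α)` "norm" of an `ℝ≥0∞`-valued function. -/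
def pnormW (n : ℕ) (α q : ℝ) (ω : Eucl n → ℝ) (F : Eucl n → ℝ≥0∞) : ℝ≥0∞ :=
  (∫⁻ x, F x ^ q * ENNReal.ofReal (ω x) ∂(nuA n α)) ^ (1 / q)

/-- Polar coordinates for the integral of a radial function over a cone. -/
lemma setLIntegral_cone_fun_norm {E : Type*} [NormedAddCommGroup E] [NormedSpace ℝ E]
    [MeasurableSpace E] [BorelSpace E] [FiniteDimensional ℝ E] (μ : Measure E)
    [μ.IsAddHaarMeasure] {C : Set E} (hC : MeasurableSet C) {f : ℝ → ℝ≥0∞} (hf : Measurable f) :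
    ∫⁻ z in {z : E | z ≠ 0 ∧ ‖z‖⁻¹ • z ∈ C}, f ‖z‖ ∂μ =
      μ.toSphere ((↑) ⁻¹' C) *
        ∫⁻ t in Set.Ioi (0 : ℝ), ENNReal.ofReal (t ^ (Module.finrank ℝ E - 1)) * f t := by
  have hm : Measurable fun z : E => ‖z‖⁻¹ • z := by fun_prop
  have hset : {z : E | z ≠ 0 ∧ ‖z‖⁻¹ • z ∈ C} = ((fun z : E => ‖z‖⁻¹ • z) ⁻¹' C) ∩ {0}ᶜ := by
    ext z; simp [and_comm]
  have h0 : MeasurableSet ({0}ᶜ : Set E) := (measurableSet_singleton _).compl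
  have hC' : MeasurableSet ((↑) ⁻¹' C : Set (sphere (0 : E) 1)) := measurable_subtype_coe hC
  rw [hset, ← Measure.restrict_restrict (hm hC), ← lintegral_indicator (hm hC),
    ← lintegral_subtype_comap h0]
  have hmp := μ.measurePreserving_homeomorphUnitSphereProd.lintegral_comp_emb
    (Homeomorph.measurableEmbedding _)
    (fun p : sphere (0 : E) 1 × Set.Ioi (0 : ℝ) =>
      ((↑) ⁻¹' C : Set (sphere (0 : E) 1)).indicator 1 p.1 * f p.2)
  have hlhs : ∀ z : ({0}ᶜ : Set E),
      ((fun z : E => ‖z‖⁻¹ • z) ⁻¹' C).indicator (fun z => f ‖z‖) (z : E) =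
      ((↑) ⁻¹' C : Set (sphere (0 : E) 1)).indicator 1 (homeomorphUnitSphereProd E z).1 *
        f (homeomorphUnitSphereProd E z).2 := by
    intro z
    by_cases h : ‖(z : E)‖⁻¹ • (z : E) ∈ C <;> simp [Set.indicator, h]
  simp_rw [hlhs]
  have hg : Measurable fun t : Set.Ioi (0 : ℝ) => f t := by fun_prop
  rw [hmp, lintegral_prod_mul (measurable_one.indicator hC').aemeasurable hg.aemeasurable,
    lintegral_indicator_one hC', Measure.volumeIoiPow,
    lintegral_withDensity_eq_lintegral_mul _ (by fun_prop) (by fun_prop)]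
  congr 1
  exact lintegral_subtype_comap measurableSet_Ioi
    (fun t : ℝ => ENNReal.ofReal (t ^ (Module.finrank ℝ E - 1)) * f t)

lemma muA_apply {n : ℕ} (α : ℝ) {S : Set (Eucl n)} (hS : MeasurableSet S) :
    muA n α S = ∫⁻ z in S ∩ ball 0 1, ENNReal.ofReal ((1 - ‖z‖ ^ 2) ^ α) := by
  rw [muA, withDensity_apply _ hS, Measure.restrict_restrict hS]

/-- The radial factor of the `muA n α`-measure of a truncated cone of height `r`. -/
def radialMass (n : ℕ) (α r : ℝ) : ℝ≥0∞ :=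
  ∫⁻ t in Set.Ioo (1 - r) 1, ENNReal.ofReal (t ^ (n - 1)) * ENNReal.ofReal ((1 - t ^ 2) ^ α)

/-- The part of the cone over `C` between the spheres of radii `1 - r` and `1`. -/
def truncCone {n : ℕ} (C : Set (Eucl n)) (r : ℝ) : Set (Eucl n) :=
  {z | (z ≠ 0 ∧ ‖z‖⁻¹ • z ∈ C) ∧ ‖z‖ ∈ Set.Ioo (1 - r) 1}

lemma measurableSet_cone {n : ℕ} {C : Set (Eucl n)} (hC : MeasurableSet C) :
    MeasurableSet {z : Eucl n | z ≠ 0 ∧ ‖z‖⁻¹ • z ∈ C} := by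
  have hm : Measurable fun z : Eucl n => ‖z‖⁻¹ • z := by fun_prop
  exact (measurableSet_singleton _).compl.inter (hm hC)

lemma measurableSet_truncCone {n : ℕ} {C : Set (Eucl n)} (hC : MeasurableSet C) (r : ℝ) :
    MeasurableSet (truncCone C r) :=
  (measurableSet_cone hC).inter (measurable_norm measurableSet_Ioo)

lemma muA_truncCone {n : ℕ} (α : ℝ) {C : Set (Eucl n)} (hC : MeasurableSet C) {r : ℝ}
    (hr : r ≤ 1) :
    muA n α (truncCone C r) =
      (volume : Measure (Eucl n)).toSphere ((↑) ⁻¹' C) * radialMass n α r := by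
  have h := setLIntegral_cone_fun_norm (volume : Measure (Eucl n)) hC
    (f := (Set.Ioo (1 - r) 1).indicator fun t => ENNReal.ofReal ((1 - t ^ 2) ^ α))
    (Measurable.indicator (by fun_prop) measurableSet_Ioo)
  have hI : MeasurableSet {z : Eucl n | ‖z‖ ∈ Set.Ioo (1 - r) 1} :=
    measurable_norm measurableSet_Ioo
  rw [muA_apply α (measurableSet_truncCone hC r)]
  have hset : truncCone C r ∩ ball 0 1 =
      {z : Eucl n | ‖z‖ ∈ Set.Ioo (1 - r) 1} ∩ {z : Eucl n | z ≠ 0 ∧ ‖z‖⁻¹ • z ∈ C} := by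
    ext z
    simp only [truncCone, Set.mem_inter_iff, Set.mem_ofPred_eq, mem_ball_zero_iff, Set.mem_Ioo]
    tauto
  rw [hset, ← Measure.restrict_restrict hI, ← lintegral_indicator hI]
  refine Eq.trans (lintegral_congr fun z => by simp [Set.indicator]) (h.trans ?_)
  congr 1
  rw [radialMass, finrank_euclideanSpace_fin]
  simp_rw [← Set.indicator_mul_right _ (fun t : ℝ => ENNReal.ofReal (t ^ (n - 1)))]
  rw [lintegral_indicator measurableSet_Ioo, Measure.restrict_restrict measurableSet_Ioo,
    Set.inter_eq_left.2]
  intro t ht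
  exact lt_of_le_of_lt (by linarith) ht.1

/-- On a compact range of positive bases, `u ^ α` is bounded above and below. -/
lemma exists_rpow_bounds (α : ℝ) {a b : ℝ} (ha : 0 < a) (hab : a ≤ b) :
    ∃ c K : ℝ, 0 < c ∧ 0 < K ∧ ∀ u ∈ Set.Icc a b, c ≤ u ^ α ∧ u ^ α ≤ K := by
  have hcont : ContinuousOn (fun u : ℝ => u ^ α) (Set.Icc a b) := fun u hu =>
    (Real.continuousAt_rpow_const u α (Or.inl (ha.trans_le hu.1).ne')).continuousWithinAt
  obtain ⟨u, hu, hmin⟩ := isCompact_Icc.exists_isMinOn (Set.nonempty_Icc.2 hab) hcont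
  obtain ⟨v, hv, hmax⟩ := isCompact_Icc.exists_isMaxOn (Set.nonempty_Icc.2 hab) hcont
  exact ⟨u ^ α, v ^ α, Real.rpow_pos_of_pos (ha.trans_le hu.1) _,
    Real.rpow_pos_of_pos (ha.trans_le hv.1) _, fun w hw => ⟨hmin hw, hmax hw⟩⟩

lemma lintegral_one_sub_rpow {α : ℝ} (hα : -1 < α) {r : ℝ} (hr : 0 ≤ r) :
    ∫⁻ t in Set.Ioo (1 - r) 1, ENNReal.ofReal ((1 - t) ^ α) =
      ENNReal.ofReal (r ^ (α + 1) / (α + 1)) := by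
  have hint : IntervalIntegrable (fun t : ℝ => (1 - t) ^ α) volume (1 - r) 1 := by
    have := (intervalIntegral.intervalIntegrable_rpow' (a := r) (b := 0) hα).comp_sub_left 1
    simpa using this
  rw [restrict_Ioo_eq_restrict_Ioc, ← ofReal_integral_eq_lintegral_ofReal hint.1,
    ← intervalIntegral.integral_of_le (by linarith),
    intervalIntegral.integral_comp_sub_left (fun t : ℝ => t ^ α) 1, integral_rpow (Or.inl hα)]
  · simp [Real.zero_rpow (by linarith : α + 1 ≠ 0)]
  · filter_upwards [ae_restrict_mem measurableSet_Ioc] with t ht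
    exact Real.rpow_nonneg (by linarith [ht.2]) _

lemma exists_radialMass_le (n : ℕ) {α : ℝ} (hα : -1 < α) :
    ∃ K : ℝ, 0 < K ∧ ∀ r : ℝ, 0 < r → r ≤ 1 →
      radialMass n α r ≤ ENNReal.ofReal (K * r ^ (α + 1)) := by
  obtain ⟨_, K, _, hK, hb⟩ := exists_rpow_bounds α one_pos one_le_two
  have hα' : 0 < α + 1 := by linarith
  refine ⟨K / (α + 1), by positivity, fun r hr hr1 => ?_⟩
  calc radialMass n α r
      ≤ ∫⁻ t in Set.Ioo (1 - r) 1, ENNReal.ofReal K * ENNReal.ofReal ((1 - t) ^ α) := by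
        refine setLIntegral_mono' measurableSet_Ioo fun t ht => ?_
        have ht0 : 0 < t := by linarith [ht.1]
        have ht1 : 0 < 1 - t := by linarith [ht.2]
        rw [← ENNReal.ofReal_mul (by positivity), ← ENNReal.ofReal_mul hK.le]
        apply ENNReal.ofReal_le_ofReal
        rw [show 1 - t ^ 2 = (1 + t) * (1 - t) by ring, Real.mul_rpow (by positivity) ht1.le]
        have h1 := (hb (1 + t) ⟨by linarith, by linarith [ht.2]⟩).2
        have h2 : t ^ (n - 1) ≤ 1 := pow_le_one₀ ht0.le ht.2.le
        calc t ^ (n - 1) * ((1 + t) ^ α * (1 - t) ^ α)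
            ≤ 1 * (K * (1 - t) ^ α) := by gcongr
          _ = _ := one_mul _
    _ = ENNReal.ofReal (K / (α + 1) * r ^ (α + 1)) := by
        rw [lintegral_const_mul _ (by fun_prop), lintegral_one_sub_rpow hα hr.le,
          ← ENNReal.ofReal_mul hK.le]
        congr 1; ring

lemma exists_le_radialMass_zero (n : ℕ) :
    ∃ k : ℝ, 0 < k ∧ ∀ r : ℝ, 0 < r → r ≤ 1 → ENNReal.ofReal (k * r) ≤ radialMass n 0 r := by
  refine ⟨(1 / 2) ^ (n - 1) / 2, by positivity, fun r hr hr1 => ?_⟩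
  calc ENNReal.ofReal ((1 / 2) ^ (n - 1) / 2 * r)
      = ∫⁻ _ in Set.Ioo (1 - r / 2) 1, ENNReal.ofReal ((1 / 2) ^ (n - 1)) := by
        rw [setLIntegral_const, Real.volume_Ioo, ← ENNReal.ofReal_mul (by positivity)]
        congr 1; ring
    _ ≤ ∫⁻ t in Set.Ioo (1 - r / 2) 1,
          ENNReal.ofReal (t ^ (n - 1)) * ENNReal.ofReal ((1 - t ^ 2) ^ (0 : ℝ)) := by
        refine setLIntegral_mono' measurableSet_Ioo fun t ht => ?_
        rw [Real.rpow_zero, ENNReal.ofReal_one, mul_one]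
        have : 1 / 2 ≤ t := by linarith [ht.1]
        gcongr
    _ ≤ radialMass n 0 r :=
        lintegral_mono_set (Set.Ioo_subset_Ioo_left (by linarith))

lemma measurableSet_sBall {n : ℕ} (x : Eucl n) (r : ℝ) : MeasurableSet (sBall x r) := by
  have h : Continuous (rho x) := Real.continuous_arccos.comp (by fun_prop)
  exact (measurable_norm (measurableSet_singleton 1)).inter (h.measurable measurableSet_Iio)

lemma cBoxBall_eq_truncCone {n : ℕ} (x : Eucl n) (r : ℝ) :
    cBoxBall x r = truncCone (sBall x r) r := by
  ext z
  simp only [cBoxBall, truncCone, Set.mem_ofPred_eq, Set.mem_Ioo]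
  refine ⟨fun ⟨h1, h2, h3⟩ => ⟨⟨?_, h3⟩, h2, h1⟩, fun ⟨⟨_, h3⟩, h2, h1⟩ => ⟨h1, h2, h3⟩⟩
  rintro rfl
  simp [sBall] at h3

/-- The chordal distance is at most the spherical one. -/
lemma norm_sub_le_rho {n : ℕ} {x y : Eucl n} (hx : ‖x‖ = 1) (hy : ‖y‖ = 1) :
    ‖y - x‖ ≤ rho x y := by
  have h0 : 0 ≤ rho x y := Real.arccos_nonneg _
  refine abs_le_of_sq_le_sq' ?_ h0 |>.2
  have hi := abs_le.1 (abs_real_inner_le_norm x y)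
  have hcos : Real.cos (rho x y) = ⟪x, y⟫ := by
    rw [hx, hy] at hi
    exact Real.cos_arccos (by linarith [hi.1]) (by linarith [hi.2])
  have := Real.one_sub_sq_div_two_le_cos (x := rho x y)
  rw [norm_sub_sq_real, hx, hy, real_inner_comm]
  linarith

lemma rho_lt_of_norm_sub_le {n : ℕ} {x y : Eucl n} (hx : ‖x‖ = 1) (hy : ‖y‖ = 1) {r : ℝ}
    (hr : 0 < r) (hr1 : r < 1) (h : ‖y - x‖ ≤ r / 2) : rho x y < r := by
  have hsq : ‖y - x‖ ^ 2 ≤ (r / 2) ^ 2 := by gcongr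
  rw [norm_sub_sq_real, hx, hy, real_inner_comm] at hsq
  have hpi := Real.pi_gt_three
  have hc := Real.cos_le_one_sub_mul_cos_sq (x := r) (by rw [abs_of_pos hr]; linarith)
  have hpi2 : 1 / 8 < 2 / Real.pi ^ 2 := by
    rw [div_lt_div_iff₀ (by norm_num) (by positivity)]
    nlinarith [Real.pi_lt_four]
  have hlt : Real.cos r < ⟪x, y⟫ := by nlinarith [mul_lt_mul_of_pos_right hpi2 (pow_pos hr 2)]
  have hle : ⟪x, y⟫ ≤ 1 := by simpa [hx, hy] using real_inner_le_norm x y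
  have := Real.arccos_lt_arccos (Real.neg_one_le_cos r) hlt hle
  rwa [Real.arccos_cos hr.le (by linarith)] at this

lemma cBoxBall_subset_ball {n : ℕ} {x : Eucl n} (hx : ‖x‖ = 1) (r : ℝ) :
    cBoxBall x r ⊆ ball x (2 * r) := by
  rintro z ⟨hz1, hzr, hy, hρ⟩
  set y := ‖z‖⁻¹ • z with hydef
  have hz0 : ‖z‖ ≠ 0 := by
    intro h0
    simp [hydef, h0] at hy
  have hz : z = ‖z‖ • y := by rw [hydef, smul_inv_smul₀ hz0]
  have h1 : ‖z - y‖ < r := by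
    have : z - y = (‖z‖ - 1) • y := by rw [sub_smul, one_smul, ← hz]
    rw [this, norm_smul, hy, mul_one, Real.norm_eq_abs, abs_lt]
    constructor <;> linarith
  have h2 := norm_sub_le_rho hx hy
  rw [mem_ball, dist_eq_norm]
  have := norm_sub_le_norm_sub_add_norm_sub z y x
  linarith

lemma norm_bounds_of_mem_ball {n : ℕ} {x z : Eucl n} (hx : ‖x‖ = 1) {r : ℝ} (hr1 : r < 1)
    (hz : z ∈ ball ((1 - r / 2) • x) (r / 10)) :
    |‖z‖ - (1 - r / 2)| < r / 10 := by
  rw [mem_ball, dist_eq_norm] at hz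
  have h := abs_norm_sub_norm_le z ((1 - r / 2) • x)
  rw [norm_smul, hx, mul_one, Real.norm_of_nonneg (by linarith)] at h
  exact h.trans_lt hz

lemma ball_subset_cBoxBall {n : ℕ} {x : Eucl n} (hx : ‖x‖ = 1) {r : ℝ} (hr : 0 < r)
    (hr1 : r < 1) : ball ((1 - r / 2) • x) (r / 10) ⊆ cBoxBall x r := by
  intro z hz
  have hb := abs_lt.1 (norm_bounds_of_mem_ball hx hr1 hz)
  have hz0 : 0 < ‖z‖ := by linarith
  rw [mem_ball, dist_eq_norm] at hz
  have hy : ‖‖z‖⁻¹ • z‖ = 1 := by rw [norm_smul, norm_inv, norm_norm, inv_mul_cancel₀ hz0.ne']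
  refine ⟨by linarith, by linarith, hy, rho_lt_of_norm_sub_le hx hy hr hr1 ?_⟩
  have hmul : ‖z‖ * ‖‖z‖⁻¹ • z - x‖ ≤ r / 5 := by
    have heq : ‖z‖ • (‖z‖⁻¹ • z - x) =
        (z - (1 - r / 2) • x) + ((1 - r / 2) - ‖z‖) • x := by
      rw [smul_sub, smul_inv_smul₀ hz0.ne', sub_smul _ ‖z‖ x]
      abel
    calc ‖z‖ * ‖‖z‖⁻¹ • z - x‖ = ‖‖z‖ • (‖z‖⁻¹ • z - x)‖ := by rw [norm_smul, norm_norm]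
      _ ≤ ‖z - (1 - r / 2) • x‖ + ‖((1 - r / 2) - ‖z‖) • x‖ := by
          rw [heq]; exact norm_add_le _ _
      _ ≤ r / 10 + r / 10 := by
          gcongr
          rw [norm_smul, hx, mul_one, Real.norm_eq_abs, abs_le]
          constructor <;> linarith
      _ = r / 5 := by ring
  nlinarith [norm_nonneg (‖z‖⁻¹ • z - x)]

lemma exists_le_muA_cBoxBall (n : ℕ) (α : ℝ) :
    ∃ c : ℝ, 0 < c ∧ ∀ (x : Eucl n) (r : ℝ), ‖x‖ = 1 → 0 < r → r < 1 →
      ENNReal.ofReal (c * r ^ ((n : ℝ) + α)) ≤ muA n α (cBoxBall x r) := by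
  obtain ⟨c, _, hc, _, hb⟩ := exists_rpow_bounds α (a := 3 / 8) (b := 5 / 4) (by norm_num)
    (by norm_num)
  set V := (volume (ball (0 : Eucl n) 1)).toReal
  have hV : ENNReal.ofReal V = volume (ball (0 : Eucl n) 1) :=
    ENNReal.ofReal_toReal measure_ball_lt_top.ne
  have hV0 : 0 < V := ENNReal.toReal_pos (measure_ball_pos _ _ one_pos).ne'
    measure_ball_lt_top.ne
  refine ⟨c * (1 / 10) ^ n * V, by positivity, fun x r hx hr hr1 => ?_⟩
  set B := ball ((1 - r / 2) • x) (r / 10)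
  have hball : ∀ z ∈ B, |‖z‖ - (1 - r / 2)| < r / 10 :=
    fun z hz => norm_bounds_of_mem_ball hx hr1 hz
  have hinter : B ∩ ball 0 1 = B := Set.inter_eq_left.2 fun z hz => by
    rw [mem_ball_zero_iff]; linarith [(abs_lt.1 (hball z hz)).2]
  calc ENNReal.ofReal (c * (1 / 10) ^ n * V * r ^ ((n : ℝ) + α))
      = ENNReal.ofReal (c * r ^ α) * volume B := by
        rw [Measure.addHaar_ball_of_pos _ _ (by positivity), finrank_euclideanSpace_fin, ← hV,
          ← ENNReal.ofReal_mul (by positivity), ← ENNReal.ofReal_mul (by positivity),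
          Real.rpow_add hr, Real.rpow_natCast]
        congr 1; ring
    _ = ∫⁻ _ in B, ENNReal.ofReal (c * r ^ α) := (setLIntegral_const _ _).symm
    _ ≤ ∫⁻ z in B, ENNReal.ofReal ((1 - ‖z‖ ^ 2) ^ α) := by
        refine setLIntegral_mono' measurableSet_ball fun z hz => ENNReal.ofReal_le_ofReal ?_
        have hz' := abs_lt.1 (hball z hz)
        have hu : (1 - ‖z‖ ^ 2) / r ∈ Set.Icc (3 / 8 : ℝ) (5 / 4) := by
          rw [Set.mem_Icc, le_div_iff₀ hr, div_le_iff₀ hr]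
          constructor <;> nlinarith [norm_nonneg z]
        have hu0 : 0 ≤ (1 - ‖z‖ ^ 2) / r := by linarith [hu.1]
        calc c * r ^ α ≤ ((1 - ‖z‖ ^ 2) / r) ^ α * r ^ α := by
              gcongr
              exact (hb _ hu).1
          _ = (1 - ‖z‖ ^ 2) ^ α := by
              rw [← Real.mul_rpow hu0 hr.le, div_mul_cancel₀ _ hr.ne']
    _ = muA n α B := by rw [muA_apply α measurableSet_ball, hinter]
    _ ≤ muA n α (cBoxBall x r) := measure_mono (ball_subset_cBoxBall hx hr hr1)

lemma muA_zero_le_volume {n : ℕ} {S : Set (Eucl n)} (hS : MeasurableSet S) :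
    muA n 0 S ≤ volume S := by
  simp only [muA_apply 0 hS, Real.rpow_zero, ENNReal.ofReal_one, setLIntegral_one]
  exact measure_mono Set.inter_subset_left

lemma exists_muA_cBoxBall_le (n : ℕ) {α : ℝ} (hα : -1 < α) :
    ∃ K : ℝ, 0 < K ∧ ∀ (x : Eucl n) (r : ℝ), ‖x‖ = 1 → 0 < r → r < 1 →
      muA n α (cBoxBall x r) ≤ ENNReal.ofReal (K * r ^ ((n : ℝ) + α)) := by
  obtain ⟨K, hK, hKr⟩ := exists_radialMass_le n hα
  obtain ⟨k, hk, hkr⟩ := exists_le_radialMass_zero n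
  set V := (volume (ball (0 : Eucl n) 1)).toReal
  have hV : ENNReal.ofReal V = volume (ball (0 : Eucl n) 1) :=
    ENNReal.ofReal_toReal measure_ball_lt_top.ne
  have hV0 : 0 < V := ENNReal.toReal_pos (measure_ball_pos _ _ one_pos).ne'
    measure_ball_lt_top.ne
  refine ⟨2 ^ n * V * K / k, by positivity, fun x r hx hr hr1 => ?_⟩
  have hmeas := measurableSet_truncCone (measurableSet_sBall x r) r
  rw [cBoxBall_eq_truncCone, muA_truncCone α (measurableSet_sBall x r) hr1.le]
  set σ := (volume : Measure (Eucl n)).toSphere ((↑) ⁻¹' sBall x r)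
  have hσ : σ * ENNReal.ofReal (k * r) ≤ ENNReal.ofReal ((2 * r) ^ n * V) := by
    calc σ * ENNReal.ofReal (k * r) ≤ σ * radialMass n 0 r := by gcongr; exact hkr r hr hr1.le
      _ = muA n 0 (truncCone (sBall x r) r) :=
          (muA_truncCone 0 (measurableSet_sBall x r) hr1.le).symm
      _ ≤ volume (truncCone (sBall x r) r) := muA_zero_le_volume hmeas
      _ ≤ volume (ball x (2 * r)) := by
          rw [← cBoxBall_eq_truncCone]
          exact measure_mono (cBoxBall_subset_ball hx r)
      _ = _ := by
          rw [Measure.addHaar_ball_of_pos _ _ (by positivity), finrank_euclideanSpace_fin, ← hV,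
            ← ENNReal.ofReal_mul (by positivity)]
  calc σ * radialMass n α r ≤ σ * ENNReal.ofReal (K * r ^ (α + 1)) := by
        gcongr; exact hKr r hr hr1.le
    _ = σ * ENNReal.ofReal (k * r) * ENNReal.ofReal (K / k * r ^ α) := by
        rw [mul_assoc, ← ENNReal.ofReal_mul (by positivity), Real.rpow_add_one hr.ne']
        congr 2; field_simp
    _ ≤ ENNReal.ofReal ((2 * r) ^ n * V) * ENNReal.ofReal (K / k * r ^ α) := by gcongr
    _ = ENNReal.ofReal (2 ^ n * V * K / k * r ^ ((n : ℝ) + α)) := by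
        rw [← ENNReal.ofReal_mul (by positivity), Real.rpow_add hr, Real.rpow_natCast]
        congr 1; ring

lemma muA_univ_lt_top {n : ℕ} (hn : n ≠ 0) {α : ℝ} (hα : -1 < α) :
    muA n α Set.univ < ∞ := by
  obtain ⟨K, -, hKr⟩ := exists_radialMass_le n hα
  have : Nonempty (Fin n) := Fin.pos_iff_nonempty.1 (Nat.pos_of_ne_zero hn)
  have hae : ((Set.univ ∩ ball 0 1 : Set (Eucl n))) =ᵐ[volume]
      (truncCone Set.univ 1 ∩ ball 0 1 : Set (Eucl n)) := by
    refine Filter.eventuallyEq_set.2 ?_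
    filter_upwards [compl_mem_ae_iff.2 (measure_singleton (0 : Eucl n))] with z hz
    have hz' : z ≠ 0 := hz
    simp [truncCone, hz']
  rw [muA_apply α .univ, setLIntegral_congr hae,
    ← muA_apply α (measurableSet_truncCone .univ 1), muA_truncCone α .univ le_rfl]
  exact ENNReal.mul_lt_top (measure_lt_top _ _)
    ((hKr 1 one_pos le_rfl).trans_lt ENNReal.ofReal_lt_top)

/-- `C₁·r^{n+α}·(2−r)^{α+1} ≤ ν_α(B̂_ρ(x,r)) ≤ C₂·r^{n+α}·(2−r)^{α+1}`
with constants depending only on `n` and `α`. -/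
theorem stmt3 (n : ℕ) (hn : 3 ≤ n) (α : ℝ) (hα : -1 < α) :
    ∃ C₁ C₂ : ℝ, 0 < C₁ ∧ 0 < C₂ ∧
      ∀ (x : Eucl n) (r : ℝ), ‖x‖ = 1 → 0 < r → r < 1 →
        ENNReal.ofReal (C₁ * r ^ ((n : ℝ) + α) * (2 - r) ^ (α + 1)) ≤
            nuA n α (cBoxBall x r) ∧
        nuA n α (cBoxBall x r) ≤
            ENNReal.ofReal (C₂ * r ^ ((n : ℝ) + α) * (2 - r) ^ (α + 1)) := by
  obtain ⟨c, hc, hlow⟩ := exists_le_muA_cBoxBall n α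
  obtain ⟨K, hK, hup⟩ := exists_muA_cBoxBall_le n hα
  have hfin : muA n α Set.univ ≠ ∞ := (muA_univ_lt_top (by omega) hα).ne
  have hpos : muA n α Set.univ ≠ 0 := by
    intro h0
    have h := hlow (EuclideanSpace.single ⟨0, by omega⟩ 1) (1 / 2) (by simp) (by norm_num)
      (by norm_num)
    rw [measure_mono_null (Set.subset_univ _) h0, nonpos_iff_eq_zero,
      ENNReal.ofReal_eq_zero] at h
    exact absurd h (not_le.2 (by positivity))
  set m := (muA n α Set.univ).toReal
  have hm : 0 < m := ENNReal.toReal_pos hpos hfin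
  have hminv : (muA n α Set.univ)⁻¹ = ENNReal.ofReal m⁻¹ := by
    rw [ENNReal.ofReal_inv_of_pos hm, ENNReal.ofReal_toReal hfin]
  have hα' : 0 ≤ α + 1 := by linarith
  refine ⟨m⁻¹ * c / 2 ^ (α + 1), m⁻¹ * K, by positivity, by positivity, fun x r hx hr hr1 => ?_⟩
  rw [nuA, Measure.smul_apply, smul_eq_mul, hminv]
  have h2r : (2 - r) ^ (α + 1) ≤ 2 ^ (α + 1) :=
    Real.rpow_le_rpow (by linarith) (by linarith) hα'
  have h1r : 1 ≤ (2 - r) ^ (α + 1) := Real.one_le_rpow (by linarith) hα'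
  constructor
  · refine le_trans ?_ (mul_le_mul_right (hlow x r hx hr hr1) _)
    rw [← ENNReal.ofReal_mul (by positivity)]
    apply ENNReal.ofReal_le_ofReal
    calc m⁻¹ * c / 2 ^ (α + 1) * r ^ ((n : ℝ) + α) * (2 - r) ^ (α + 1)
        ≤ m⁻¹ * c / 2 ^ (α + 1) * r ^ ((n : ℝ) + α) * 2 ^ (α + 1) := by gcongr
      _ = m⁻¹ * (c * r ^ ((n : ℝ) + α)) := by field_simp
  · refine (mul_le_mul_right (hup x r hx hr hr1) _).trans ?_
    rw [← ENNReal.ofReal_mul (by positivity), ← mul_assoc]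
    exact ENNReal.ofReal_le_ofReal (le_mul_of_one_le_right (by positivity) h1r)
end
end

section
/- Let (X, μ) be a σ-finite measure space, let {Q_j}_{j∈J} be a countable family of measurable sets with 0 < μ(Q_j) < ∞, let {E_j}_{j∈J} be pairwise disjoint measurable sets with E_j ⊆ Q_j and μ(Q_j) ≤ C₄·μ(E_j) for all j, and let ω be a measurable function with ω > 0 a.e. and 0 < ∫_{Q_j} ω dμ < ∞, 0 < ∫_{Q_j} ω^{−1} dμ < ∞ for all j. Set [ω]_𝒟 = sup_j (∫_{Q_j} ω dμ)(∫_{Q_j} ω^{−1} dμ)/μ(Q_j)², define M_ω g = sup_j χ_{Q_j}·(∫_{Q_j} |g| ω dμ)/(∫_{Q_j} ω dμ) and M_{ω^{−1}} f analogously with ω^{−1} in place of ω, and assume ‖M_ω g‖_{L²(ω dμ)} ≤ c₉‖g‖_{L²(ω dμ)} and ‖M_{ω^{−1}} f‖_{L²(ω^{−1} dμ)} ≤ c₉‖f‖_{L²(ω^{−1} dμ)} for all f, g. Then for all measurable f, g ≥ 0: Σ_j (1/μ(Q_j))·(∫_{Q_j} f ω^{−1} dμ)·(∫_{Q_j} g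 ω dμ) ≤ C₄·c₉²·[ω]_𝒟·‖f‖_{L²(ω^{−1} dμ)}·‖g‖_{L²(ω dμ)}. -/
open MeasureTheory Metric
open scoped ENNReal RealInnerProductSpace

noncomputable section

/-- `∫_S w dμ` as a lower integral. -/
def wqInt {X : Type*} [MeasurableSpace X] (μ : Measure X) (w : X → ℝ) (S : Set X) :
    ℝ≥0∞ :=
  ∫⁻ x in S, ENNReal.ofReal (w x) ∂μ

/-- The dyadic weighted maximal operator
`M_w g = sup_j χ_{Q_j}·(∫_{Q_j} |g| w dμ)/(∫_{Q_j} w dμ)`. -/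
def dyadMax {X : Type*} [MeasurableSpace X] (μ : Measure X) {J : Type*}
    (Q : J → Set X) (w g : X → ℝ) (x : X) : ℝ≥0∞ :=
  ⨆ j, (Q j).indicator
    (fun _ => (∫⁻ y in Q j, ENNReal.ofReal |g y| * ENNReal.ofReal (w y) ∂μ) /
      wqInt μ w (Q j)) x

/-- The `L²(w dμ)` norm of an `ℝ≥0∞`-valued function. -/
def nrm2 {X : Type*} [MeasurableSpace X] (μ : Measure X) (w : X → ℝ)
    (F : X → ℝ≥0∞) : ℝ≥0∞ :=
  (∫⁻ x, F x ^ 2 * ENNReal.ofReal (w x) ∂μ) ^ (1 / 2 : ℝ)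

lemma measurable_dyadMax {X : Type*} [MeasurableSpace X] (μ : Measure X) {J : Type*}
    [Countable J] {Q : J → Set X} (hQm : ∀ j, MeasurableSet (Q j)) (w g : X → ℝ) :
    Measurable (dyadMax μ Q w g) :=
  Measurable.iSup fun j => measurable_const.indicator (hQm j)

lemma setLIntegral_div_le_dyadMax {X : Type*} [MeasurableSpace X] (μ : Measure X) {J : Type*}
    (Q : J → Set X) (w g : X → ℝ) (hg : ∀ x, 0 ≤ g x) {j : J} {x : X} (hx : x ∈ Q j) :
    (∫⁻ y in Q j, ENNReal.ofReal (g y) * ENNReal.ofReal (w y) ∂μ) / wqInt μ w (Q j) ≤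
      dyadMax μ Q w g x := by
  refine le_trans ?_ (le_iSup _ j)
  simp only [Set.indicator_of_mem hx, abs_of_nonneg (hg _), le_refl]

/-- Cauchy–Schwarz for the pairing between `L²(w⁻¹ dμ)` and `L²(w dμ)`. -/
lemma lintegral_mul_le_nrm2_mul_nrm2 {X : Type*} [MeasurableSpace X] (μ : Measure X)
    {w : X → ℝ} (hw : Measurable w) (hpos : ∀ᵐ x ∂μ, 0 < w x) {F G : X → ℝ≥0∞}
    (hF : Measurable F) (hG : Measurable G) :
    ∫⁻ x, F x * G x ∂μ ≤ nrm2 μ (fun x => (w x)⁻¹) F * nrm2 μ w G := by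
  have hsq (a b : ℝ≥0∞) : (a * b ^ (1 / 2 : ℝ)) ^ (2 : ℝ) = a ^ 2 * b := by
    rw [ENNReal.mul_rpow_of_nonneg _ _ zero_le_two, ← ENNReal.rpow_mul, ENNReal.rpow_two]
    norm_num
  have hCS := ENNReal.lintegral_mul_le_Lp_mul_Lq μ Real.HolderConjugate.two_two
    (f := fun x => F x * ENNReal.ofReal (w x)⁻¹ ^ (1 / 2 : ℝ))
    (g := fun x => G x * ENNReal.ofReal (w x) ^ (1 / 2 : ℝ))
    (by fun_prop) (by fun_prop)
  simp only [hsq] at hCS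
  refine le_trans (lintegral_mono_ae ?_) hCS
  filter_upwards [hpos] with x hx
  have hone : ENNReal.ofReal (w x)⁻¹ ^ (1 / 2 : ℝ) * ENNReal.ofReal (w x) ^ (1 / 2 : ℝ) = 1 := by
    rw [← ENNReal.mul_rpow_of_nonneg _ _ (by norm_num), ← ENNReal.ofReal_mul (by positivity),
      inv_mul_cancel₀ hx.ne', ENNReal.ofReal_one, ENNReal.one_rpow]
  simp only [Pi.mul_apply]
  rw [mul_mul_mul_comm, hone, mul_one]

lemma tsum_setLIntegral_le_lintegral {X : Type*} [MeasurableSpace X] (μ : Measure X) {J : Type*}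
    [Countable J] {A : J → Set X} (hA : ∀ j, MeasurableSet (A j))
    (hdisj : Pairwise (Function.onFun Disjoint A)) (F : X → ℝ≥0∞) :
    ∑' j, ∫⁻ x in A j, F x ∂μ ≤ ∫⁻ x, F x ∂μ := by
  rw [← lintegral_iUnion hA hdisj]
  exact setLIntegral_le_lintegral _ _

/-- the key bilinear estimate
`Σ_j (1/μ(Q_j))·(∫_{Q_j} f ω⁻¹ dμ)·(∫_{Q_j} g ω dμ)
  ≤ C₄·c₉²·[ω]_𝒟·‖f‖_{L²(ω⁻¹dμ)}·‖g‖_{L²(ωdμ)}`. -/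
theorem stmt12 {X : Type*} [MeasurableSpace X] (μ : Measure X) [SigmaFinite μ]
    {J : Type*} [Countable J]
    (Q A : J → Set X) (hQm : ∀ j, MeasurableSet (Q j))
    (hAm : ∀ j, MeasurableSet (A j))
    (hQpos : ∀ j, 0 < μ (Q j)) (hQfin : ∀ j, μ (Q j) < ⊤)
    (hdisj : Pairwise (Function.onFun Disjoint A)) (hAQ : ∀ j, A j ⊆ Q j)
    (C₄ : ℝ) (hC : ∀ j, μ (Q j) ≤ ENNReal.ofReal C₄ * μ (A j))
    (ω : X → ℝ) (hωm : Measurable ω) (hωpos : ∀ᵐ x ∂μ, 0 < ω x)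
    (hωQ : ∀ j, 0 < wqInt μ ω (Q j) ∧ wqInt μ ω (Q j) < ⊤)
    (hωinvQ : ∀ j, 0 < wqInt μ (fun x => (ω x)⁻¹) (Q j) ∧
      wqInt μ (fun x => (ω x)⁻¹) (Q j) < ⊤)
    (c₉ : ℝ)
    (hMω : ∀ g : X → ℝ,
      nrm2 μ ω (dyadMax μ Q ω g) ≤
        ENNReal.ofReal c₉ * nrm2 μ ω (fun x => ENNReal.ofReal |g x|))
    (hMωinv : ∀ f : X → ℝ,
      nrm2 μ (fun x => (ω x)⁻¹) (dyadMax μ Q (fun x => (ω x)⁻¹) f) ≤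
        ENNReal.ofReal c₉ * nrm2 μ (fun x => (ω x)⁻¹) (fun x => ENNReal.ofReal |f x|))
    (f g : X → ℝ) (hf : Measurable f) (hg : Measurable g)
    (hf0 : ∀ x, 0 ≤ f x) (hg0 : ∀ x, 0 ≤ g x) :
    ∑' j, (μ (Q j))⁻¹ *
        ((∫⁻ x in Q j, ENNReal.ofReal (f x) * ENNReal.ofReal ((ω x)⁻¹) ∂μ) *
          (∫⁻ x in Q j, ENNReal.ofReal (g x) * ENNReal.ofReal (ω x) ∂μ)) ≤
      ENNReal.ofReal C₄ * ENNReal.ofReal c₉ ^ 2 *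
        (⨆ j, wqInt μ ω (Q j) * wqInt μ (fun x => (ω x)⁻¹) (Q j) / μ (Q j) ^ 2) *
        (nrm2 μ (fun x => (ω x)⁻¹) (fun x => ENNReal.ofReal (f x)) *
          nrm2 μ ω (fun x => ENNReal.ofReal (g x))) := by
  set K := ⨆ j, wqInt μ ω (Q j) * wqInt μ (fun x => (ω x)⁻¹) (Q j) / μ (Q j) ^ 2
  set Mf := dyadMax μ Q (fun x => (ω x)⁻¹) f
  set Mg := dyadMax μ Q ω g
  have hterm (j : J) : (μ (Q j))⁻¹ *
        ((∫⁻ x in Q j, ENNReal.ofReal (f x) * ENNReal.ofReal ((ω x)⁻¹) ∂μ) *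
          (∫⁻ x in Q j, ENNReal.ofReal (g x) * ENNReal.ofReal (ω x) ∂μ)) ≤
      ENNReal.ofReal C₄ * K * ∫⁻ x in A j, Mf x * Mg x ∂μ := by
    set I := ∫⁻ x in Q j, ENNReal.ofReal (f x) * ENNReal.ofReal ((ω x)⁻¹) ∂μ
    set L := ∫⁻ x in Q j, ENNReal.ofReal (g x) * ENNReal.ofReal (ω x) ∂μ
    set s := wqInt μ (fun x => (ω x)⁻¹) (Q j)
    set t := wqInt μ ω (Q j)
    set m := μ (Q j)
    have hI : I = I / s * s := (ENNReal.div_mul_cancel (hωinvQ j).1.ne' (hωinvQ j).2.ne).symm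
    have hL : L = L / t * t := (ENNReal.div_mul_cancel (hωQ j).1.ne' (hωQ j).2.ne).symm
    have hm : m⁻¹ = (m ^ 2)⁻¹ * m := by
      rw [pow_two, ENNReal.mul_inv (Or.inl (hQpos j).ne') (Or.inl (hQfin j).ne), mul_assoc,
        ENNReal.inv_mul_cancel (hQpos j).ne' (hQfin j).ne, mul_one]
    calc m⁻¹ * (I * L) = t * s / m ^ 2 * m * (I / s * (L / t)) := by
          conv_lhs => rw [hI, hL, hm]
          simp only [div_eq_mul_inv]
          ring
      _ ≤ K * (ENNReal.ofReal C₄ * μ (A j)) * (I / s * (L / t)) := by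
          gcongr
          · exact le_iSup (fun j => wqInt μ ω (Q j) * wqInt μ (fun x => (ω x)⁻¹) (Q j) /
              μ (Q j) ^ 2) j
          · exact hC j
      _ = ENNReal.ofReal C₄ * K * ∫⁻ _ in A j, I / s * (L / t) ∂μ := by
          rw [setLIntegral_const]
          ring
      _ ≤ ENNReal.ofReal C₄ * K * ∫⁻ x in A j, Mf x * Mg x ∂μ := by
          refine mul_le_mul' le_rfl (setLIntegral_mono' (hAm j) fun x hx => ?_)
          exact mul_le_mul' (setLIntegral_div_le_dyadMax μ Q _ f hf0 (hAQ j hx))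
            (setLIntegral_div_le_dyadMax μ Q ω g hg0 (hAQ j hx))
  have hMf := hMωinv f
  have hMg := hMω g
  simp only [abs_of_nonneg (hf0 _)] at hMf
  simp only [abs_of_nonneg (hg0 _)] at hMg
  calc _ ≤ ∑' j, ENNReal.ofReal C₄ * K * ∫⁻ x in A j, Mf x * Mg x ∂μ :=
        ENNReal.tsum_le_tsum hterm
    _ ≤ ENNReal.ofReal C₄ * K * ∫⁻ x, Mf x * Mg x ∂μ := by
        rw [ENNReal.tsum_mul_left]
        gcongr
        exact tsum_setLIntegral_le_lintegral μ hAm hdisj _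
    _ ≤ ENNReal.ofReal C₄ * K * (nrm2 μ (fun x => (ω x)⁻¹) Mf * nrm2 μ ω Mg) := by
        gcongr
        exact lintegral_mul_le_nrm2_mul_nrm2 μ hωm hωpos (measurable_dyadMax μ hQm _ _)
          (measurable_dyadMax μ hQm _ _)
    _ ≤ ENNReal.ofReal C₄ * K *
          ((ENNReal.ofReal c₉ * nrm2 μ (fun x => (ω x)⁻¹) fun x => ENNReal.ofReal (f x)) *
            (ENNReal.ofReal c₉ * nrm2 μ ω fun x => ENNReal.ofReal (g x))) := by
        gcongr
    _ = _ := by ring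
end
end

section
/- Let n ≥ 3, −1 < α < ∞, p > 2 with 1/p + 1/p' = 1 and φ(p) = (p−2)/(p−1), and let ω be a weight on 𝔹_n with ω > 0 a.e. If A₀ ≥ 0 is such that ‖M_α g‖_{L^{p'}(ω^{1−p'} dν_α)} ≤ A₀·‖g‖_{L^{p'}(ω^{1−p'} dν_α)} for all g, then for every measurable h ≥ 0 on 𝔹_n, ‖S_{ω,α}(h)‖_{L^{p'/φ(p)}(ω dν_α)} ≤ A₀^{φ(p)}·‖h‖_{L^{p'/φ(p)}(ω dν_α)}, where S_{ω,α}(h) = (M_α(h^{1/φ(p)} ω)/ω)^{φ(p)}. (Note p'/φ(p) = p/(p−2).) -/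
open MeasureTheory Metric
open scoped ENNReal RealInnerProductSpace

noncomputable section

/-- The operator `S_{ω,α}(h) = (M_α(h^{1/φ} ω)/ω)^φ`. -/
def sOp (n : ℕ) (α φ : ℝ) (ω h : Eucl n → ℝ) (x : Eucl n) : ℝ≥0∞ :=
  (maxOp n α (fun y => h y ^ (1 / φ) * ω y) x / ENNReal.ofReal (ω x)) ^ φ

/-- `‖F^φ‖_{L^{q/φ}(ω)} = ‖F‖_{L^q(ω)}^φ`. -/
lemma pnormW_rpow (n : ℕ) (α q φ : ℝ) (hφ : 0 < φ) (ω : Eucl n → ℝ) (F : Eucl n → ℝ≥0∞) :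
    pnormW n α (q / φ) ω (fun x => F x ^ φ) = pnormW n α q ω F ^ φ := by
  unfold pnormW
  simp only [← ENNReal.rpow_mul, mul_div_cancel₀ q hφ.ne', one_div_div, one_div_mul_eq_div]

/-- Passing from the weight `ω` to the dual weight `ω^{1-q}` amounts to dividing by `ω`. -/
lemma pnormW_div_weight (n : ℕ) (α q : ℝ) (hq : 0 ≤ q) (ω : Eucl n → ℝ)
    (hω : ∀ᵐ x ∂nuA n α, 0 < ω x) (F : Eucl n → ℝ≥0∞) :
    pnormW n α q ω (fun x => F x / ENNReal.ofReal (ω x)) =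
      pnormW n α q (fun x => ω x ^ (1 - q)) F := by
  unfold pnormW
  congr 1
  refine lintegral_congr_ae ?_
  filter_upwards [hω] with x hx
  have h0 : ENNReal.ofReal (ω x) ≠ 0 := by simpa using hx
  rw [← ENNReal.ofReal_rpow_of_pos hx, ENNReal.div_rpow_of_nonneg _ _ hq,
    ENNReal.rpow_sub _ _ h0 ENNReal.ofReal_ne_top, ENNReal.rpow_one]
  simp only [div_eq_mul_inv]
  ring

lemma pnormW_congr_ae (n : ℕ) (α q : ℝ) (ω : Eucl n → ℝ) {F G : Eucl n → ℝ≥0∞}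
    (hFG : F =ᵐ[nuA n α] G) : pnormW n α q ω F = pnormW n α q ω G := by
  unfold pnormW
  congr 1
  refine lintegral_congr_ae ?_
  filter_upwards [hFG] with x hx
  rw [hx]

/-- if `M_α` is bounded on `L^{p'}(ω^{1−p'}dν_α)` with norm `A₀`, then
`‖S_{ω,α}(h)‖_{L^{p'/φ(p)}(ωdν_α)} ≤ A₀^{φ(p)}·‖h‖_{L^{p'/φ(p)}(ωdν_α)}` for all
`h ≥ 0`, where `φ(p) = (p−2)/(p−1)`. -/
theorem stmt16 (n : ℕ) (hn : 3 ≤ n) (α : ℝ) (hα : -1 < α) (p p' : ℝ) (hp : 2 < p)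
    (hpp' : 1 / p + 1 / p' = 1)
    (ω : Eucl n → ℝ) (hωm : Measurable ω) (hωpos : ∀ᵐ x ∂nuA n α, 0 < ω x)
    (A₀ : ℝ) (hA₀ : 0 ≤ A₀)
    (hM : ∀ g : Eucl n → ℝ,
      pnormW n α p' (fun x => ω x ^ (1 - p')) (maxOp n α g) ≤
        ENNReal.ofReal A₀ *
          pnormW n α p' (fun x => ω x ^ (1 - p')) (fun x => ENNReal.ofReal |g x|)) :
    ∀ h : Eucl n → ℝ, Measurable h → (∀ x, 0 ≤ h x) →
      pnormW n α (p' / ((p - 2) / (p - 1))) ω (sOp n α ((p - 2) / (p - 1)) ω h) ≤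
        ENNReal.ofReal A₀ ^ ((p - 2) / (p - 1)) *
          pnormW n α (p' / ((p - 2) / (p - 1))) ω (fun x => ENNReal.ofReal (h x)) := by
  intro h _ hh
  have hφ : 0 < (p - 2) / (p - 1) := div_pos (by linarith) (by linarith)
  have hq : 0 ≤ p' := by
    have h1 : 1 / p < 1 := by rw [div_lt_one] <;> linarith
    exact (one_div_pos.mp (by linarith)).le
  generalize (p - 2) / (p - 1) = φ at hφ ⊢
  have key := ENNReal.rpow_le_rpow (hM fun y => h y ^ (1 / φ) * ω y) hφ.le
  rw [ENNReal.mul_rpow_of_nonneg _ _ hφ.le, ← pnormW_div_weight n α p' hq ω hωpos,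
    ← pnormW_div_weight n α p' hq ω hωpos, ← pnormW_rpow n α p' φ hφ,
    ← pnormW_rpow n α p' φ hφ] at key
  refine key.trans_eq ?_
  congr 1
  refine pnormW_congr_ae n α _ ω ?_
  filter_upwards [hωpos] with x hx
  have hg : 0 ≤ h x ^ (1 / φ) := Real.rpow_nonneg (hh x) _
  rw [abs_of_nonneg (mul_nonneg hg hx.le), ← ENNReal.ofReal_div_of_pos hx,
    mul_div_cancel_right₀ _ hx.ne', ENNReal.ofReal_rpow_of_nonneg hg hφ.le,
    ← Real.rpow_mul (hh x), one_div_mul_cancel hφ.ne', Real.rpow_one]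
end
end

section
/- Let n ≥ 3, −1 < α < ∞, p > 2 with 1/p + 1/p' = 1 and φ(p) = (p−2)/(p−1). Let ω be a weight on 𝔹_n with ω > 0 a.e. and [ω]_{p,α} < ∞, and let h ≥ 0 be measurable on 𝔹_n. Then for every ball B_ρ = B_ρ(x,r) with x ∈ ∂𝔹_n and 0 < r < 1: ((1/|B̂_ρ|_α)∫_{B̂_ρ} h ω dν_α) · ((1/|B̂_ρ|_α)∫_{B̂_ρ} (S_{ω,α}(h) ω)^{−1} dν_α) ≤ [ω]_{p,α}^{1/(p−1)}, where S_{ω,α}(h) = (M_α(h^{1/φ(p)} ω)/ω)^{φ(p)}. -/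
open MeasureTheory Metric
open scoped ENNReal RealInnerProductSpace

noncomputable section

theorem measurableSet_cBoxBall {n : ℕ} (x : Eucl n) (r : ℝ) :
    MeasurableSet (cBoxBall x r) := by
  have hm : Measurable fun z : Eucl n => ‖z‖⁻¹ • z := by fun_prop
  have hrho : Measurable fun y : Eucl n => rho x y :=
    Real.continuous_arccos.measurable.comp
      (Continuous.inner continuous_const continuous_id).measurable
  have hs : MeasurableSet (sBall x r) :=
    (measurableSet_eq_fun measurable_norm measurable_const).inter (hrho measurableSet_Iio)
  exact (measurable_norm measurableSet_Iio).inter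
    ((measurable_norm measurableSet_Ioi).inter (hm hs))

/-- Hölder's inequality for `∫ f w = ∫ (f w ^ φ) w ^ (1 - φ)`, where `φ = (p - 2) / (p - 1)`. -/
theorem lintegral_mul_weight_le {X : Type*} [MeasurableSpace X] (m : Measure X) {p : ℝ}
    (hp : 2 < p) {f w : X → ℝ≥0∞} (hf : Measurable f) (hw : Measurable w) :
    ∫⁻ x, f x * w x ∂m ≤
      (∫⁻ x, f x ^ (1 / ((p - 2) / (p - 1))) * w x ∂m) ^ ((p - 2) / (p - 1)) *
        (∫⁻ x, w x ∂m) ^ (1 / (p - 1)) := by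
  have h1 : 0 < p - 1 := by linarith
  have h2 : 0 < p - 2 := by linarith
  set φ := (p - 2) / (p - 1) with hφ
  have hφ0 : 0 < φ := by positivity
  have hsum : φ + 1 / (p - 1) = 1 := by rw [hφ]; field_simp; ring
  have hconj : (1 / φ).HolderConjugate (p - 1) := by
    rw [Real.holderConjugate_iff]
    refine ⟨?_, by simpa using hsum⟩
    rw [lt_div_iff₀ hφ0, one_mul]
    have : 0 < 1 / (p - 1) := by positivity
    linarith
  have key := ENNReal.lintegral_mul_le_Lp_mul_Lq m hconj
    (f := fun x => f x * w x ^ φ) (g := fun x => w x ^ (1 / (p - 1)))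
    (hf.mul (hw.pow_const _)).aemeasurable (hw.pow_const _).aemeasurable
  have e1 : ∀ x, f x * w x ^ φ * w x ^ (1 / (p - 1)) = f x * w x := fun x => by
    rw [mul_assoc, ← ENNReal.rpow_add_of_nonneg _ _ hφ0.le (by positivity), hsum,
      ENNReal.rpow_one]
  have e2 : ∀ x, (f x * w x ^ φ) ^ (1 / φ) = f x ^ (1 / φ) * w x := fun x => by
    rw [ENNReal.mul_rpow_of_nonneg _ _ (by positivity), ← ENNReal.rpow_mul,
      mul_one_div_cancel hφ0.ne', ENNReal.rpow_one]
  have e3 : ∀ x, (w x ^ (1 / (p - 1))) ^ (p - 1) = w x := fun x => by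
    rw [← ENNReal.rpow_mul, one_div_mul_cancel h1.ne', ENNReal.rpow_one]
  simpa only [Pi.mul_apply, e1, e2, e3, one_div_one_div] using key

/-- A function `M` bounded below by `∫ f ^ (1 / φ) w`, where `φ = (p - 2) / (p - 1)`, yields a
weight `(M / w) ^ φ * w` whose reciprocal pairs with `f w` below the `A_p` product of `w`. -/
theorem lintegral_mul_lintegral_inv_le {X : Type*} [MeasurableSpace X] (m : Measure X) {p : ℝ}
    (hp : 2 < p) {f w M : X → ℝ≥0∞} (hf : Measurable f) (hw : Measurable w)
    (hwt : ∀ x, w x ≠ ⊤) (hw0 : ∀ᵐ x ∂m, w x ≠ 0)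
    (hM : ∀ᵐ x ∂m, ∫⁻ y, f y ^ (1 / ((p - 2) / (p - 1))) * w y ∂m ≤ M x) :
    (∫⁻ x, f x * w x ∂m) * ∫⁻ x, ((M x / w x) ^ ((p - 2) / (p - 1)) * w x)⁻¹ ∂m ≤
      ((∫⁻ x, w x ∂m) * (∫⁻ x, w x ^ (1 - p / (p - 1)) ∂m) ^ (p - 1)) ^ (1 / (p - 1)) := by
  have h1 : 0 < p - 1 := by linarith
  have h2 : 0 < p - 2 := by linarith
  have hold := lintegral_mul_weight_le m hp hf hw
  set φ := (p - 2) / (p - 1) with hφ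
  have hφ0 : 0 < φ := by positivity
  have hexp : 1 - p / (p - 1) = φ - 1 := by rw [hφ]; field_simp; ring
  set A := ∫⁻ y, f y ^ (1 / φ) * w y ∂m
  rcases eq_or_ne A 0 with hA | hA
  · rw [hA, ENNReal.zero_rpow_of_pos hφ0, zero_mul, nonpos_iff_eq_zero] at hold
    simp [hold]
  rcases eq_or_ne A ⊤ with hA' | hA'
  · have : ∫⁻ x, ((M x / w x) ^ φ * w x)⁻¹ ∂m = 0 := by
      rw [← lintegral_zero (μ := m)]
      refine lintegral_congr_ae ?_
      filter_upwards [hw0, hM] with x hx hx'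
      rw [hA', top_le_iff] at hx'
      rw [hx', ENNReal.top_div_of_ne_top (hwt x), ENNReal.top_rpow_of_pos hφ0,
        ENNReal.top_mul hx, ENNReal.inv_top]
    simp [this]
  have hY : ∫⁻ x, ((M x / w x) ^ φ * w x)⁻¹ ∂m ≤
      (A ^ φ)⁻¹ * ∫⁻ x, w x ^ (1 - p / (p - 1)) ∂m := by
    rw [← lintegral_const_mul _ (hw.pow_const _)]
    refine lintegral_mono_ae ?_
    filter_upwards [hw0, hM] with x hx hx'
    calc ((M x / w x) ^ φ * w x)⁻¹ ≤ ((A / w x) ^ φ * w x)⁻¹ := by gcongr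
      _ = (A ^ φ * w x ^ (1 - φ))⁻¹ := by
        rw [ENNReal.div_rpow_of_nonneg _ _ hφ0.le, div_eq_mul_inv, mul_assoc,
          ← ENNReal.rpow_neg, sub_eq_neg_add, ENNReal.rpow_add _ _ hx (hwt x),
          ENNReal.rpow_one]
      _ = (A ^ φ)⁻¹ * w x ^ (1 - p / (p - 1)) := by
        rw [ENNReal.mul_inv (Or.inl (by simp [hA, hA'])) (Or.inl ?_), hexp,
          ← ENNReal.rpow_neg (w x), neg_sub]
        exact ENNReal.rpow_ne_top_of_nonneg hφ0.le hA'
  have hAφ0 : A ^ φ ≠ 0 := by simp [hA, hA']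
  have hAφt : A ^ φ ≠ ⊤ := ENNReal.rpow_ne_top_of_nonneg hφ0.le hA'
  rw [ENNReal.mul_rpow_of_nonneg _ _ (by positivity), ← ENNReal.rpow_mul,
    mul_one_div_cancel h1.ne', ENNReal.rpow_one]
  refine (mul_le_mul' hold hY).trans_eq ?_
  rw [mul_mul_mul_comm, ENNReal.mul_inv_cancel hAφ0 hAφt, one_mul]

theorem le_maxOp {n : ℕ} {α : ℝ} (f : Eucl n → ℝ) {x y : Eucl n} {r : ℝ} (hx : ‖x‖ = 1)
    (hr : 0 < r) (hr1 : r < 1) (hy : y ∈ cBoxBall x r) :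
    (∫⁻ z in cBoxBall x r, ENNReal.ofReal |f z| ∂nuA n α) / nuA n α (cBoxBall x r) ≤
      maxOp n α f y := by
  refine le_iSup₂_of_le x hx (le_iSup₂_of_le r hr (le_iSup_of_le hr1 ?_))
  rw [Set.indicator_of_mem hy]

/-- for every ball `B_ρ`,
`((1/|B̂_ρ|_α)∫_{B̂_ρ} h ω dν_α)·((1/|B̂_ρ|_α)∫_{B̂_ρ} (S_{ω,α}(h)ω)^{−1} dν_α)
  ≤ [ω]_{p,α}^{1/(p−1)}`, where `φ(p) = (p−2)/(p−1)`. -/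
theorem stmt17 (n : ℕ) (hn : 3 ≤ n) (α : ℝ) (hα : -1 < α) (p p' : ℝ) (hp : 2 < p)
    (hpp' : 1 / p + 1 / p' = 1)
    (ω : Eucl n → ℝ) (hωm : Measurable ω) (hωpos : ∀ᵐ x ∂nuA n α, 0 < ω x)
    (hBB : BB n p α ω ≠ ⊤)
    (h : Eucl n → ℝ) (hhm : Measurable h) (hh0 : ∀ x, 0 ≤ h x) :
    ∀ (x : Eucl n) (r : ℝ), ‖x‖ = 1 → 0 < r → r < 1 →
      ((∫⁻ y in cBoxBall x r,
            ENNReal.ofReal (h y) * ENNReal.ofReal (ω y) ∂nuA n α) /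
          nuA n α (cBoxBall x r)) *
        ((∫⁻ y in cBoxBall x r,
            (sOp n α ((p - 2) / (p - 1)) ω h y * ENNReal.ofReal (ω y))⁻¹ ∂nuA n α) /
          nuA n α (cBoxBall x r)) ≤
        BB n p α ω ^ (1 / (p - 1)) := by
  intro x r hx hr hr1
  have h1 : 0 < p - 1 := by linarith
  have hφ0 : 0 < (p - 2) / (p - 1) := div_pos (by linarith) h1
  set B := cBoxBall x r with hB
  have hae : ∀ᵐ y ∂(nuA n α B)⁻¹ • (nuA n α).restrict B, 0 < ω y ∧ y ∈ B :=
    Measure.ae_smul_measure ((ae_restrict_of_ae hωpos).and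
      (ae_restrict_mem (measurableSet_cBoxBall x r))) _
  have havg : ∀ F : Eucl n → ℝ≥0∞, (∫⁻ y in B, F y ∂nuA n α) / nuA n α B =
      ∫⁻ y, F y ∂(nuA n α B)⁻¹ • (nuA n α).restrict B := fun F => by
    rw [lintegral_smul_measure, smul_eq_mul, div_eq_mul_inv, mul_comm]
  have hBBle : (wInt α ω B / nuA n α B) *
      (wInt α (fun y => ω y ^ (1 - p / (p - 1))) B / nuA n α B) ^ (p - 1) ≤ BB n p α ω :=
    le_iSup₂_of_le x hx (le_iSup₂_of_le r hr (le_iSup_of_le hr1 le_rfl))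
  refine le_trans ?_ (ENNReal.rpow_le_rpow hBBle (by positivity))
  have hmax := fun y => le_maxOp (n := n) (α := α) (y := y)
    (fun y => h y ^ (1 / ((p - 2) / (p - 1))) * ω y) hx hr hr1
  simp only [← hB, havg] at hmax
  simp only [wInt, havg]
  have hpow : ∫⁻ y, ENNReal.ofReal (ω y ^ (1 - p / (p - 1)))
        ∂(nuA n α B)⁻¹ • (nuA n α).restrict B =
      ∫⁻ y, ENNReal.ofReal (ω y) ^ (1 - p / (p - 1))
        ∂(nuA n α B)⁻¹ • (nuA n α).restrict B := by
    refine lintegral_congr_ae ?_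
    filter_upwards [hae] with y hy
    rw [ENNReal.ofReal_rpow_of_pos hy.1]
  rw [hpow]
  refine lintegral_mul_lintegral_inv_le _ hp hhm.ennreal_ofReal hωm.ennreal_ofReal
    (fun _ => ENNReal.ofReal_ne_top) ?_ ?_
  · filter_upwards [hae] with y hy
    simpa using hy.1
  · filter_upwards [hae] with y hy
    refine le_trans (le_of_eq (lintegral_congr_ae ?_)) (hmax y hy.2)
    filter_upwards [hae] with z hz
    have hhz := Real.rpow_nonneg (hh0 z) (1 / ((p - 2) / (p - 1)))
    rw [abs_of_nonneg (mul_nonneg hhz hz.1.le), ENNReal.ofReal_mul hhz,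
      ENNReal.ofReal_rpow_of_nonneg (hh0 z) (by positivity)]
end
end
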